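/- arXiv:1310.1520 — 2 statements merged into one kernel-verified Lean document; each statement's English description precedes it below -/
import Mathlib

section
/- The number of 312-avoiding permutations of length d having exactly k components (equivalently, exactly k cut points when the last position n = d is counted as a cut point, i.e., permutations that decompose as a concatenation A_1A_2⋯A_k of k indecomposable blocks with every letter of A_i smaller than every letter of A_j for i < j) equals (k/d)·binomial(2d−k−1, d−1). -/
/-- A permutation `π ∈ S_d` avoids the pattern 312 if there are no indices
`i < j < k` with `π j < π k < π i`. -/
def Avoids312 {d : ℕ} (π : Equiv.Perm (Fin d)) : Prop :=
  ¬ ∃ i j k : Fin d, i < j ∧ j < k ∧ π j < π k ∧ π k < π i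

/-- The number of components of `π` equals the number of positions `j` (0-indexed,
the last position included, where the condition holds vacuously) such that every
letter in a position `≤ j` is smaller than every letter in a position `> j`;
these are the cut points with the last position counted as a cut point. -/
def numComponents {d : ℕ} (π : Equiv.Perm (Fin d)) : ℕ :=
  (Finset.univ.filter fun j : Fin d => ∀ i l : Fin d, i ≤ j → j < l → π i < π l).card

namespace Av312

def IsCut {d : ℕ} (σ : Equiv.Perm (Fin d)) (j : Fin d) : Prop :=
  ∀ i l : Fin d, i ≤ j → j < l → σ i < σ l

def Good {d : ℕ} (σ : Equiv.Perm (Fin d)) (v : Fin (d + 1)) : Prop :=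
  ∀ i : Fin d, (σ i).val < v.val ↔ i.val < v.val

lemma mem_lower {d : ℕ} (s : Finset (Fin d)) (h : ∀ i j, i ≤ j → j ∈ s → i ∈ s) (i : Fin d) :
    i ∈ s ↔ i.val < s.card := by
  constructor
  · intro hi
    have : Finset.Iic i ⊆ s := fun x hx => h x i (by simpa using hx) hi
    have := Finset.card_le_card this
    simp at this
    omega
  · intro hi
    by_contra hn
    have : s ⊆ Finset.Iio i := by
      intro x hx
      simp only [Finset.mem_Iio]
      by_contra hlt
      exact hn (h i x (not_lt.mp hlt) hx)
    have := Finset.card_le_card this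
    simp at this
    omega

lemma card_lt {d : ℕ} (v : Fin (d + 1)) :
    (Finset.univ.filter fun i : Fin d => i.val < v.val).card = v.val := by
  rw [Fin.card_filter_val_lt]
  have := v.2
  omega

lemma good_of_valid {d : ℕ} (σ : Equiv.Perm (Fin d)) (v : Fin (d + 1))
    (h : ∀ i j : Fin d, i < j → (σ j).val < v.val → (σ i).val < v.val) : Good σ v := by
  intro i
  have hc : (Finset.univ.filter fun i : Fin d => (σ i).val < v.val).card = v.val := by
    refine (Finset.card_equiv σ ?_).trans (card_lt v)
    intro i; simp
  have := mem_lower (Finset.univ.filter fun i : Fin d => (σ i).val < v.val) (by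
    intro a b hab hb
    rcases hab.eq_or_lt with rfl | hlt
    · exact hb
    · simp only [Finset.mem_filter, Finset.mem_univ, true_and] at hb ⊢
      exact h a b hlt hb) i
  rw [hc] at this
  simpa using this

lemma good_of_cut {d : ℕ} (σ : Equiv.Perm (Fin d)) (v : Fin (d + 1))
    (h : ∀ i l : Fin d, i.val < v.val → v.val ≤ l.val → σ i < σ l) : Good σ v := by
  intro i
  have hc : (Finset.univ.filter fun i : Fin d => (σ.symm i).val < v.val).card = v.val := by
    refine (Finset.card_equiv σ.symm ?_).trans (card_lt v)
    intro i; simp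
  have := mem_lower (Finset.univ.filter fun i : Fin d => (σ.symm i).val < v.val) (by
    intro a b hab hb
    simp only [Finset.mem_filter, Finset.mem_univ, true_and] at hb ⊢
    by_contra hlt
    have := h _ _ hb (not_lt.mp hlt)
    simp at this
    exact absurd hab (not_le.mpr this)) (σ i)
  rw [hc] at this
  simpa using this.symm

lemma isCut_iff {d : ℕ} (σ : Equiv.Perm (Fin d)) (j : Fin d) : IsCut σ j ↔ Good σ j.succ := by
  constructor
  · intro h
    apply good_of_cut
    intro i l hi hl
    simp at hi hl
    exact h i l (Fin.le_def.2 (by omega)) (Fin.lt_def.2 (by omega))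
  · intro h i l hi hl
    have h1 := h i
    have h2 := h l
    simp only [Fin.val_succ] at h1 h2
    rw [Fin.le_def] at hi
    rw [Fin.lt_def] at hl ⊢
    omega

/-- Append the value `v` at the end of `σ`. -/
def child {d : ℕ} (p : Fin (d + 1) × Equiv.Perm (Fin d)) : Equiv.Perm (Fin (d + 1)) :=
  (finSuccEquivLast.trans (Equiv.optionCongr p.2)).trans (finSuccEquiv' p.1).symm

@[simp] lemma child_last {d : ℕ} (p : Fin (d + 1) × Equiv.Perm (Fin d)) :
    child p (Fin.last d) = p.1 := by
  simp [child]

@[simp] lemma child_castSucc {d : ℕ} (p : Fin (d + 1) × Equiv.Perm (Fin d)) (i : Fin d) :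
    child p i.castSucc = p.1.succAbove (p.2 i) := by
  simp [child]

lemma child_bij (d : ℕ) : Function.Bijective (child (d := d)) := by
  rw [Fintype.bijective_iff_injective_and_card]
  constructor
  · rintro ⟨v, σ⟩ ⟨w, τ⟩ h
    have h1 : v = w := by
      have := congrArg (fun e => e (Fin.last d)) h
      simpa using this
    subst h1
    congr 1
    ext i
    have := congrArg (fun e => e i.castSucc) h
    simp at this
    rw [this]
  · simp [Fintype.card_perm, Nat.factorial_succ]

lemma sa_lt_iff {d : ℕ} (v : Fin (d + 1)) (x : Fin d) : v.succAbove x < v ↔ x.val < v.val := by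
  rw [Fin.succAbove_lt_iff_castSucc_lt, Fin.lt_def]; simp

lemma avoids_child {d : ℕ} (v : Fin (d + 1)) (σ : Equiv.Perm (Fin d)) :
    Avoids312 (child (v, σ)) ↔ Avoids312 σ ∧ Good σ v := by
  constructor
  · intro h
    refine ⟨?_, ?_⟩
    · rintro ⟨i, j, k, hij, hjk, h1, h2⟩
      exact h ⟨i.castSucc, j.castSucc, k.castSucc, by simpa, by simpa, by simpa, by simpa⟩
    · apply good_of_valid
      intro i j hij hj
      by_contra hi
      refine h ⟨i.castSucc, j.castSucc, Fin.last d, by simpa, Fin.castSucc_lt_last j, ?_, ?_⟩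
      · simpa [sa_lt_iff] using hj
      · have h1 := (sa_lt_iff v (σ i)).not.2 hi
        have h2 := Fin.succAbove_ne v (σ i)
        simp only [child_castSucc, child_last]
        exact lt_of_le_of_ne (not_lt.mp h1) h2.symm
  · rintro ⟨h, hg⟩ ⟨i, j, k, hij, hjk, h1, h2⟩
    induction j using Fin.lastCases with
    | last => exact absurd hjk (not_lt.mpr (Fin.le_last k))
    | cast j =>
    induction i using Fin.lastCases with
    | last => exact absurd hij (not_lt.mpr (Fin.le_last _))
    | cast i =>
    induction k using Fin.lastCases with
    | last =>
      simp only [child_castSucc, child_last] at h1 h2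
      have h3 := (hg j).1 ((sa_lt_iff v _).1 h1)
      have h4 : i < j := by simpa using hij
      have h5 := (hg i).2 (lt_trans h4 h3)
      exact absurd h2 (not_lt.mpr ((sa_lt_iff v _).2 h5).le)
    | cast k =>
      simp only [child_castSucc, Fin.succAbove_lt_succAbove_iff, Fin.castSucc_lt_castSucc_iff] at *
      exact h ⟨i, j, k, hij, hjk, h1, h2⟩

lemma cut_child {d : ℕ} (v : Fin (d + 1)) (σ : Equiv.Perm (Fin d)) (hg : Good σ v) (j : Fin d) :
    IsCut (child (v, σ)) j.castSucc ↔ IsCut σ j ∧ j.val < v.val := by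
  constructor
  · intro h
    refine ⟨?_, ?_⟩
    · intro i l hi hl
      have := h i.castSucc l.castSucc (by simpa) (by simpa)
      simpa using this
    · have := h j.castSucc (Fin.last d) le_rfl (Fin.castSucc_lt_last j)
      simp only [child_castSucc, child_last] at this
      exact (hg j).1 ((sa_lt_iff v _).1 this)
  · rintro ⟨h, hj⟩ i l hi hl
    induction i using Fin.lastCases with
    | last => exact absurd (lt_of_le_of_lt hi hl) (not_lt.mpr (Fin.le_last _))
    | cast i =>
    have hi' : i ≤ j := by simpa using hi
    induction l using Fin.lastCases with
    | last =>
      simp only [child_castSucc, child_last]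
      exact (sa_lt_iff v _).2 ((hg i).2 (lt_of_le_of_lt hi' hj))
    | cast l =>
      simp only [child_castSucc, Fin.succAbove_lt_succAbove_iff]
      exact h i l hi' (by simpa using hl)

open Classical in
lemma num_eq {d : ℕ} (σ : Equiv.Perm (Fin d)) :
    numComponents σ = (Finset.univ.filter fun j => IsCut σ j).card := by
  unfold numComponents IsCut
  congr

open Classical in
/-- number of cuts before `v` -/
noncomputable def rk {d : ℕ} (σ : Equiv.Perm (Fin d)) (v : Fin (d + 1)) : ℕ :=
  (Finset.univ.filter fun j : Fin d => IsCut σ j ∧ j.val < v.val).card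

lemma num_child {d : ℕ} (v : Fin (d + 1)) (σ : Equiv.Perm (Fin d)) (hg : Good σ v) :
    numComponents (child (v, σ)) = rk σ v + 1 := by
  classical
  rw [num_eq, Finset.card_filter, Fin.sum_univ_castSucc, rk, Finset.card_filter]
  congr 1
  · apply Finset.sum_congr rfl
    intro j _
    simp only [cut_child v σ hg]
  · rw [if_pos]
    intro i l _ hl
    exact absurd hl (not_lt.mpr (Fin.le_last l))

lemma good_zero {d : ℕ} (σ : Equiv.Perm (Fin d)) : Good σ 0 := by
  intro i; simp

open Classical in
lemma card_good {d : ℕ} (σ : Equiv.Perm (Fin d)) :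
    (Finset.univ.filter fun v => Good σ v).card = numComponents σ + 1 := by
  rw [num_eq, Finset.card_filter, Fin.sum_univ_succ, Finset.card_filter, if_pos (good_zero σ),
    add_comm]
  simp only [isCut_iff]

lemma rk_le {d : ℕ} (σ : Equiv.Perm (Fin d)) (v : Fin (d + 1)) : rk σ v ≤ numComponents σ := by
  classical
  rw [num_eq, rk]
  apply Finset.card_le_card
  intro j; simp; tauto

lemma rk_lt {d : ℕ} (σ : Equiv.Perm (Fin d)) (v w : Fin (d + 1)) (hw : Good σ w) (h : v < w) :
    rk σ v < rk σ w := by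
  classical
  unfold rk
  apply Finset.card_lt_card
  rw [Fin.lt_def] at h
  rw [Finset.ssubset_iff_of_subset]
  · have hne : w ≠ 0 := by rintro rfl; simp at h
    obtain ⟨j, rfl⟩ := Fin.exists_succ_eq.2 hne
    simp only [Fin.val_succ] at h
    refine ⟨j, ?_, ?_⟩
    · simp [isCut_iff, hw]
    · simp; intro _; omega
  · intro j
    simp
    intro h1 h2
    exact ⟨h1, by omega⟩

open Classical in
lemma card_fiber {d : ℕ} (σ : Equiv.Perm (Fin d)) (k : ℕ) :
    (Finset.univ.filter fun v => Good σ v ∧ rk σ v = k).card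
      = if k ≤ numComponents σ then 1 else 0 := by
  have hinj : Set.InjOn (rk σ) (Finset.univ.filter fun v => Good σ v : Finset _) := by
    intro v hv w hw h
    simp at hv hw
    rcases lt_trichotomy v w with h1 | h1 | h1
    · have := rk_lt σ v w hw h1; omega
    · exact h1
    · have := rk_lt σ w v hv h1; omega
  have himg : (Finset.univ.filter fun v => Good σ v).image (rk σ)
      = Finset.range (numComponents σ + 1) := by
    apply Finset.eq_of_subset_of_card_le
    · intro x hx
      simp only [Finset.mem_image] at hx
      obtain ⟨v, _, rfl⟩ := hx
      have := rk_le σ v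
      simp; omega
    · rw [Finset.card_image_of_injOn hinj, card_good]; simp
  split_ifs with hk
  · have : k ∈ (Finset.univ.filter fun v => Good σ v).image (rk σ) := by
      rw [himg]; simp; omega
    simp only [Finset.mem_image] at this
    obtain ⟨v, hv, rfl⟩ := this
    rw [Finset.card_eq_one]
    refine ⟨v, ?_⟩
    ext w
    simp only [Finset.mem_filter, Finset.mem_univ, true_and, Finset.mem_singleton]
    constructor
    · rintro ⟨h1, h2⟩
      exact hinj (by simpa using h1) hv h2
    · rintro rfl
      exact ⟨by simpa using hv, rfl⟩
  · rw [Finset.card_eq_zero, Finset.filter_eq_empty_iff]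
    rintro v - ⟨_, rfl⟩
    exact hk (rk_le σ v)

open Classical in
noncomputable def cnt (d k : ℕ) : ℕ :=
  (Finset.univ.filter fun π : Equiv.Perm (Fin d) => Avoids312 π ∧ numComponents π = k).card

open Classical in
lemma cnt_succ (d k : ℕ) : cnt (d + 1) (k + 1) =
    (Finset.univ.filter fun π : Equiv.Perm (Fin d) => Avoids312 π ∧ k ≤ numComponents π).card := by
  have h1 : cnt (d + 1) (k + 1) = (Finset.univ.filter
      fun p : Fin (d + 1) × Equiv.Perm (Fin d) =>
        Avoids312 p.2 ∧ Good p.2 p.1 ∧ rk p.2 p.1 = k).card := by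
    symm
    apply Finset.card_equiv (Equiv.ofBijective child (child_bij d))
    rintro ⟨v, σ⟩
    simp only [Finset.mem_filter, Finset.mem_univ, true_and, Equiv.ofBijective_apply, avoids_child]
    constructor
    · rintro ⟨a, b, c⟩
      exact ⟨⟨a, b⟩, by rw [num_child v σ b, c]⟩
    · rintro ⟨⟨a, b⟩, c⟩
      rw [num_child v σ b] at c
      exact ⟨a, b, by omega⟩
  rw [h1, Finset.card_filter, Fintype.sum_prod_type_right, Finset.card_filter]
  apply Finset.sum_congr rfl
  intro σ _
  by_cases ha : Avoids312 σ
  · simp only [ha, true_and]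
    rw [← Finset.card_filter, card_fiber]
  · simp [ha]

lemma cnt_rec (d k : ℕ) : cnt (d + 1) (k + 1) = cnt d k + cnt (d + 1) (k + 2) := by
  classical
  rw [cnt_succ, cnt_succ, cnt, ← Finset.card_union_of_disjoint]
  · congr 1
    ext π
    simp only [Finset.mem_filter, Finset.mem_univ, true_and, Finset.mem_union]
    rw [← and_or_left]
    apply and_congr_right
    intro _
    omega
  · rw [Finset.disjoint_filter]
    rintro π - ⟨_, h⟩ ⟨_, h'⟩
    omega

lemma num_le {d : ℕ} (σ : Equiv.Perm (Fin d)) : numComponents σ ≤ d := by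
  unfold numComponents
  exact (Finset.card_le_univ _).trans (by simp)

lemma cnt_gt (d k : ℕ) (h : d < k) : cnt d k = 0 := by
  classical
  rw [cnt, Finset.card_eq_zero, Finset.filter_eq_empty_iff]
  rintro σ - ⟨_, rfl⟩
  have := num_le σ
  omega

lemma cnt_zero_zero : cnt 0 0 = 1 := by
  classical
  have : ∀ π : Equiv.Perm (Fin 0), Avoids312 π ∧ numComponents π = 0 := by
    intro π
    refine ⟨?_, ?_⟩
    · rintro ⟨i, _⟩; exact i.elim0
    · have := num_le π; omega
  simp [cnt, this]

lemma cnt_succ_zero (d : ℕ) : cnt (d + 1) 0 = 0 := by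
  classical
  rw [cnt, Finset.card_eq_zero, Finset.filter_eq_empty_iff]
  rintro π - ⟨_, h⟩
  rw [num_eq, Finset.card_eq_zero, Finset.filter_eq_empty_iff] at h
  apply h (Finset.mem_univ (Fin.last d))
  intro i l _ hl
  exact absurd hl (not_lt.mpr (Fin.le_last l))

/-- `d = e+1`, `k = e+1-m`. -/
lemma formula (e : ℕ) : ∀ m k, k + m = e + 1 →
    (e + 1) * cnt (e + 1) k = k * (e + m).choose e := by
  induction e with
  | zero =>
    intro m k h
    have h11 : cnt 1 1 = 1 := by
      rw [cnt_rec 0 0, cnt_zero_zero, cnt_gt 1 2 (by omega)]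
    rcases k with _ | k
    · simp [cnt_succ_zero]
    · obtain rfl : k = 0 := by omega
      simp [h11]
  | succ e ih =>
    intro m
    induction m with
    | zero =>
      intro k h
      obtain rfl : k = e + 2 := by omega
      have h1 := ih 0 (e + 1) (by omega)
      simp at h1
      rw [cnt_rec, h1, cnt_gt _ _ (by omega)]
      simp
    | succ m ihm =>
      intro k h
      rcases k with _ | k
      · simp [cnt_succ_zero]
      · have h1 := ih (m + 1) k (by omega)
        have h2 := ihm (k + 2) (by omega)
        rw [cnt_rec (e + 1) k]
        obtain rfl : e = k + m := by omega
        have h3 := Nat.choose_succ_right_eq (k + m + m + 1) (k + m)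
        rw [show k + m + m + 1 - (k + m) = m + 1 by omega] at h3
        rw [show k + m + (m + 1) = k + m + m + 1 by omega] at h1
        rw [show k + m + 1 + m = k + m + m + 1 by omega] at h2
        rw [show k + m + 1 + (m + 1) = k + m + m + 1 + 1 by omega, Nat.choose_succ_succ']
        generalize (k + m + m + 1).choose (k + m) = X at *
        generalize (k + m + m + 1).choose (k + m + 1) = Y at *
        generalize cnt (k + m + 1) k = a at *
        generalize cnt (k + m + 1 + 1) (k + 2) = b at *
        apply Nat.eq_of_mul_eq_mul_left (Nat.succ_pos (k + m))
        zify at *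
        push_cast at *
        linear_combination (k + m + 2 : ℤ) * h1 + (k + m + 1 : ℤ) * h2 + h3

end Av312

/-- The number of 312-avoiding permutations of length `d` with exactly `k` components
equals `(k/d) · binomial (2d-k-1) (d-1)`. -/
theorem card_312_avoiding_with_k_components (d k : ℕ) (hk : 1 ≤ k) (hkd : k ≤ d) :
    (Nat.card {π : Equiv.Perm (Fin d) // Avoids312 π ∧ numComponents π = k} : ℚ)
      = (k : ℚ) / (d : ℚ) * ((2 * d - k - 1).choose (d - 1) : ℚ) := by
  classical
  obtain ⟨e, rfl⟩ : ∃ e, d = e + 1 := ⟨d - 1, by omega⟩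
  have h := Av312.formula e (e + 1 - k) k (by omega)
  have hc : Nat.card {π : Equiv.Perm (Fin (e + 1)) // Avoids312 π ∧ numComponents π = k}
      = Av312.cnt (e + 1) k := by
    rw [Nat.card_eq_fintype_card, Fintype.card_subtype, Av312.cnt]
  rw [hc, show 2 * (e + 1) - k - 1 = e + (e + 1 - k) by omega, Nat.add_sub_cancel]
  have hq : ((e + 1 : ℕ) : ℚ) * Av312.cnt (e + 1) k = k * ((e + (e + 1 - k)).choose e : ℕ) := by
    exact_mod_cast h
  have hne : ((e + 1 : ℕ) : ℚ) ≠ 0 := by positivity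
  field_simp
  linarith
end

section
/- For every integer k with 1 ≤ k ≤ d, the number of 312-avoiding affine permutations in the affine symmetric group on d letters that have exactly k cut points modulo d equals binomial(2d−k−1, d−1). -/
/-- An affine permutation in `S̃_d` is a bijection `π : ℤ → ℤ` with
`π (i + d) = π i + d` for all `i` and `Σ_{i=0}^{d-1} (π i - i) = 0`. -/
def IsAffinePerm (d : ℕ) (π : ℤ ≃ ℤ) : Prop :=
  (∀ i : ℤ, π (i + d) = π i + d) ∧ ∑ i ∈ Finset.range d, (π i - i) = 0

/-- A bijection `π : ℤ → ℤ` is 312-avoiding if there are no integers `i < j < k`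
with `π j < π k < π i`. -/
def Avoids312Z (π : ℤ ≃ ℤ) : Prop :=
  ¬ ∃ i j k : ℤ, i < j ∧ j < k ∧ π j < π k ∧ π k < π i

/-- `j` is a cut point of `π : ℤ → ℤ` if `π i < π k` for all `i ≤ j < k`. -/
def IsCutPointZ (π : ℤ ≃ ℤ) (j : ℤ) : Prop :=
  ∀ i k : ℤ, i ≤ j → j < k → π i < π k


namespace Aff

lemma bddL {d : ℕ} (hd : 1 ≤ d) (f : ℤ → ℤ) (h : ∀ i, f (i + d) ≤ f i) (i : ℤ) :
    ∃ C, ∀ j, j < i → C ≤ f j := by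
  have hne : (Finset.Ico (i - d) i).Nonempty := ⟨i - 1, by simp; omega⟩
  obtain ⟨x, -, hx⟩ := Finset.exists_min_image _ f hne
  refine ⟨f x, ?_⟩
  have key : ∀ n : ℕ, ∀ j, i - d - n ≤ j → j < i → f x ≤ f j := by
    intro n
    induction n with
    | zero => intro j h1 h2; exact hx j (by simp; omega)
    | succ n ih =>
      intro j h1 h2
      by_cases h3 : j < i - d
      · exact (ih (j + d) (by push_cast at h1; omega) (by omega)).trans (h j)
      · exact hx j (by simp; omega)
  intro j hj
  exact key (i - d - j).toNat j (by omega) hj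

/-- `M` is the running maximum of `π`. -/
def RM (π : ℤ ≃ ℤ) (M : ℤ → ℤ) : Prop :=
  ∀ i, (∃ j, j ≤ i ∧ π j = M i) ∧ ∀ j, j ≤ i → π j ≤ M i

/-- `q` is the last time before `i` with level at most that of `i`. -/
def Sq (M : ℤ → ℤ) (i q : ℤ) : Prop :=
  q < i ∧ M q - q ≤ M i - i ∧ ∀ j, q < j → j < i → M i - i < M j - j

lemma Sq.unique {M : ℤ → ℤ} {i q q' : ℤ} (h : Sq M i q) (h' : Sq M i q') : q = q' := by
  obtain ⟨h1, h2, h3⟩ := h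
  obtain ⟨h1', h2', h3'⟩ := h'
  rcases lt_trichotomy q q' with h | h | h
  · have := h3 q' h h1'; omega
  · exact h
  · have := h3' q h h1; omega

lemma exists_Sq {d : ℕ} (hd : 1 ≤ d) {M : ℤ → ℤ} (hM : ∀ i, M (i + d) = M i + d) (i : ℤ) :
    ∃ q, Sq M i q := by
  obtain ⟨q, ⟨h1, h2⟩, h3⟩ := Int.exists_greatest_of_bdd
    (P := fun q => q < i ∧ M q - q ≤ M i - i) ⟨i, fun z hz => hz.1.le⟩
    ⟨i - d, by omega, by have := hM (i - d); simp at this; omega⟩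
  refine ⟨q, h1, h2, fun j hj hj' => ?_⟩
  by_contra hc
  have := h3 j ⟨hj', by omega⟩
  omega

lemma exists_RM {d : ℕ} (hd : 1 ≤ d) (π : ℤ ≃ ℤ) (h : ∀ i, π (i + d) = π i + d) :
    ∃ M, RM π M := by
  have : ∀ i, ∃ m, (∃ j, j ≤ i ∧ π j = m) ∧ ∀ j, j ≤ i → π j ≤ m := by
    intro i
    obtain ⟨C, hC⟩ := bddL hd (fun j => j - π j) (fun j => by simp only [h]; omega) (i + 1)
    obtain ⟨m, h1, h2⟩ := Int.exists_greatest_of_bdd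
      (P := fun m => ∃ j, j ≤ i ∧ π j = m)
      ⟨i - C, by rintro z ⟨j, hj, rfl⟩; have := hC j (by omega); omega⟩
      ⟨π i, i, le_rfl, rfl⟩
    exact ⟨m, h1, fun j hj => h2 _ ⟨j, hj, rfl⟩⟩
  choose M hM using this
  exact ⟨M, hM⟩

lemma RM.unique {π : ℤ ≃ ℤ} {M M' : ℤ → ℤ} (h : RM π M) (h' : RM π M') : M = M' := by
  funext i
  obtain ⟨⟨j, hj, e⟩, a⟩ := h i
  obtain ⟨⟨j', hj', e'⟩, a'⟩ := h' i
  have := a j' hj'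
  have := a' j hj
  omega

lemma RM.mono {π : ℤ ≃ ℤ} {M : ℤ → ℤ} (h : RM π M) : Monotone M := by
  intro i i' hi
  obtain ⟨⟨j, hj, e⟩, a⟩ := h i
  have := (h i').2 j (by omega)
  omega

lemma RM.per {d : ℕ} {π : ℤ ≃ ℤ} (hp : ∀ i, π (i + d) = π i + d) {M : ℤ → ℤ} (h : RM π M)
    (i : ℤ) : M (i + d) = M i + d := by
  obtain ⟨⟨j, hj, e⟩, a⟩ := h i
  obtain ⟨⟨j', hj', e'⟩, a'⟩ := h (i + d)
  have h1 := a' (j + d) (by omega)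
  have h2 := a (j' - d) (by omega)
  have h3 := hp (j' - d)
  rw [hp] at h1
  simp at h3
  omega

/-- reconstruction of a 312-avoiding permutation from its running maximum -/
lemma formula {d : ℕ} (hd : 1 ≤ d) {π : ℤ ≃ ℤ} (hp : ∀ i, π (i + d) = π i + d)
    (ha : Avoids312Z π) {M : ℤ → ℤ} (h : RM π M) (i : ℤ) :
    ∃ q, Sq M i q ∧ π i = M i - i + q + 1 := by
  obtain ⟨C, hC⟩ := bddL hd (fun j => j - π j) (fun j => by simp only [hp]; omega) i
  obtain ⟨p, hpv, hpm⟩ := Int.exists_least_of_bdd (P := fun j => π i ≤ π j)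
    ⟨min i (π i + C), by
      intro z hz
      by_cases hzi : z < i
      · have := hC z hzi
        omega
      · omega⟩ ⟨i, le_rfl⟩
  have hpi : p ≤ i := hpm i le_rfl
  have hin : ∀ j, p ≤ j → j < i → π i < π j := by
    intro j h1 h2
    by_contra hc
    have hne : π j ≠ π i := fun e => by have := π.injective e; omega
    have hne' : π p ≠ π i := fun e => by have := π.injective e; omega
    have hne'' : p ≠ j := by rintro rfl; omega
    exact ha ⟨p, j, i, by omega, h2, by omega, by omega⟩
  have hlow : M (p - 1) < π i := by
    obtain ⟨⟨j, hj, e⟩, -⟩ := h (p - 1)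
    by_contra hc
    have := hpm j (by omega)
    omega
  have himg : (Finset.Ico p i).map π.toEmbedding = Finset.Ioc (π i) (M i) := by
    ext w
    simp only [Finset.mem_map_equiv, Finset.mem_Ico, Finset.mem_Ioc]
    constructor
    · rintro ⟨h1, h2⟩
      have := hin _ h1 h2
      have h3 := (h i).2 _ h2.le
      simp at this h3
      exact ⟨this, h3⟩
    · rintro ⟨h1, h2⟩
      have hw : π (π.symm w) = w := by simp
      refine ⟨hpm _ (by rw [hw]; exact h1.le), ?_⟩
      by_contra hc
      obtain ⟨⟨m, hm, e⟩, -⟩ := h i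
      have hne : m ≠ i := by rintro rfl; omega
      have hne2 : π.symm w ≠ i := by intro e; rw [e] at hw; omega
      have hne3 : w ≠ M i := by
        intro e'; rw [e', ← e] at hc; simp at hc; omega
      exact ha ⟨m, i, π.symm w, by omega, by omega, by omega, by omega⟩
  have hcard := congrArg Finset.card himg
  simp only [Finset.card_map, Int.card_Ico, Int.card_Ioc] at hcard
  have hMi := (h i).2 i le_rfl
  refine ⟨p - 1, ⟨by omega, by omega, ?_⟩, by omega⟩
  intro j h1 h2
  have hsub : (Finset.Icc p j).map π.toEmbedding ⊆ Finset.Ioc (π i) (M j) := by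
    intro w
    simp only [Finset.mem_map_equiv, Finset.mem_Icc, Finset.mem_Ioc]
    rintro ⟨h3, h4⟩
    have := hin _ h3 (by omega)
    have h5 := (h j).2 _ h4
    simp at this h5
    exact ⟨this, h5⟩
  have hc2 := Finset.card_le_card hsub
  simp only [Finset.card_map, Int.card_Icc, Int.card_Ioc] at hc2
  have := hin p le_rfl (by omega)
  have := (h j).2 p (by omega)
  omega

lemma RM.inj {d : ℕ} (hd : 1 ≤ d) {π π' : ℤ ≃ ℤ} (hp : ∀ i, π (i + d) = π i + d)
    (ha : Avoids312Z π) (hp' : ∀ i, π' (i + d) = π' i + d)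
    (ha' : Avoids312Z π') {M : ℤ → ℤ} (h : RM π M) (h' : RM π' M) : π = π' := by
  ext i
  obtain ⟨q, hq, e⟩ := formula hd hp ha h i
  obtain ⟨q', hq', e'⟩ := formula hd hp' ha' h' i
  rw [hq.unique hq'] at e
  omega

lemma step {M : ℤ → ℤ} (hm : Monotone M) {q : ℤ → ℤ} (hq : ∀ i, Sq M i (q i)) {i i' : ℤ}
    (hi : i < i') : (i ≤ q i' → M i - i + q i + 1 < M i' - i' + q i' + 1) ∧
      (q i' < i → M i' - i' + q i' + 1 < M i - i + q i + 1) := by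
  obtain ⟨a1, a2, a3⟩ := hq i
  obtain ⟨b1, b2, b3⟩ := hq i'
  constructor
  · intro h
    have := hm h
    omega
  · intro h
    have := b3 i h hi
    by_contra hc
    have := a3 (q i') (by omega) h
    omega

lemma exists_perm {d : ℕ} (hd : 1 ≤ d) {M : ℤ → ℤ} (hm : Monotone M)
    (hM : ∀ i, M (i + d) = M i + d) :
    ∃ π : ℤ ≃ ℤ, (∀ i, π (i + d) = π i + d) ∧ Avoids312Z π ∧ RM π M := by
  choose q hq using exists_Sq hd hM
  have hqp : ∀ i, q (i + d) = q i + d := by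
    intro i
    refine (hq (i + d)).unique ⟨?_, ?_, ?_⟩
    · have := (hq i).1; omega
    · have := (hq i).2.1; rw [hM, hM]; omega
    · intro j h1 h2
      have := (hq i).2.2 (j - d) (by omega) (by omega)
      have h3 := hM (j - d)
      simp at h3
      rw [hM]; omega
  set f : ℤ → ℤ := fun i => M i - i + q i + 1 with hf
  have hst : ∀ i i', i < i' → (i ≤ q i' → f i < f i') ∧ (q i' < i → f i' < f i) :=
    fun i i' h => step hm hq h
  have hinj : Function.Injective f := by
    have : ∀ i i', i < i' → f i ≠ f i' := by
      intro i i' h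
      rcases le_or_gt i (q i') with h1 | h1
      · exact ((hst i i' h).1 h1).ne
      · exact ((hst i i' h).2 h1).ne'
    intro i i' e
    rcases lt_trichotomy i i' with h | h | h
    · exact absurd e (this _ _ h)
    · exact h
    · exact absurd e.symm (this _ _ h)
  obtain ⟨C0, hC0⟩ : ∃ C, ∀ i, M i - i ≤ C := by
    obtain ⟨C, hC⟩ := bddL hd (fun j => j - M j) (fun j => by simp only [hM]; omega) 0
    refine ⟨-C, fun i => ?_⟩
    have hn : ∀ n : ℕ, M (i - n * d) = M i - n * d := by
      intro n
      induction n with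
      | zero => simp
      | succ n ih =>
        have h1 := hM (i - (n + 1 : ℕ) * d)
        have h2 : i - ((n + 1 : ℕ) : ℤ) * d + d = i - n * d := by push_cast; ring
        rw [h2, ih] at h1
        push_cast at h1 ⊢
        linarith
    have h1 := hn (i.toNat + 1)
    have h2 : i - ((i.toNat + 1 : ℕ) : ℤ) * d < 0 := by
      have : (1 : ℤ) ≤ d := by exact_mod_cast hd
      push_cast
      nlinarith [Int.self_le_toNat i, Int.natCast_nonneg i.toNat]
    have h3 := hC _ h2
    omega
  have hsurj : Function.Surjective f := by
    intro v
    obtain ⟨p, hp1, hp2⟩ := Int.exists_least_of_bdd (P := fun i => v ≤ M i)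
      ⟨v - C0, fun z hz => by have := hC0 z; omega⟩ (by
        obtain ⟨C, hC⟩ := bddL hd (fun j => M j - j) (fun j => by simp only [hM]; omega) (max 0 v + 1)
        by_contra hc
        push Not at hc
        have hn : ∀ n : ℕ, M (0 + n * d) = M 0 + n * d := by
          intro n
          induction n with
          | zero => simp
          | succ n ih =>
            have h1 := hM (0 + n * d)
            have h2 : 0 + ((n + 1 : ℕ) : ℤ) * d = 0 + n * d + d := by push_cast; ring
            rw [h2, h1, ih]
            push_cast
            ring
        have h1 := hn (v - M 0).toNat
        have h2 := hc (0 + (v - M 0).toNat * d)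
        have : (1 : ℤ) ≤ d := by exact_mod_cast hd
        nlinarith [Int.self_le_toNat (v - M 0), Int.natCast_nonneg (v - M 0).toNat])
    have hpl : M (p - 1) < v := by
      by_contra hc
      have := hp2 (p - 1) (by omega)
      omega
    obtain ⟨i, ⟨hi1, hi2⟩, hi3⟩ := Int.exists_least_of_bdd
      (P := fun i => p ≤ i ∧ M i - i ≤ v - p) ⟨p, fun z hz => hz.1⟩
      ⟨p - 1 + d, by omega, by rw [hM]; omega⟩
    have heq : M i - i = v - p := by
      rcases hi1.eq_or_lt with rfl | h
      · omega
      · by_contra hc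
        have := hi3 (i - 1) ⟨by omega, by have := hm (show i - 1 ≤ i by omega); omega⟩
        omega
    have : q i = p - 1 := by
      refine (hq i).unique ⟨by omega, by omega, ?_⟩
      intro j h1 h2
      by_contra hc
      have := hi3 j ⟨by omega, by omega⟩
      omega
    refine ⟨i, ?_⟩
    simp only [hf, this]
    omega
  obtain ⟨π, hπ⟩ : ∃ π : ℤ ≃ ℤ, ∀ i, π i = f i :=
    ⟨Equiv.ofBijective f ⟨hinj, hsurj⟩, fun i => rfl⟩
  refine ⟨π, ?_, ?_, ?_⟩
  · intro i
    simp only [hπ, hf, hM, hqp]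
    ring
  · rintro ⟨i, j, k, h1, h2, h3, h4⟩
    simp only [hπ] at h3 h4
    have : j ≤ q k := by
      by_contra hc
      have := (hst j k h2).2 (by omega)
      omega
    have := (hst i k (by omega)).1 (by omega)
    omega
  · intro i
    simp only [hπ]
    constructor
    · obtain ⟨p, hp1, hp2⟩ := Int.exists_least_of_bdd (P := fun j => M i ≤ M j)
        ⟨M i - C0, fun z hz => by have := hC0 z; omega⟩ ⟨i, le_rfl⟩
      have hpi := hp2 i le_rfl
      have h1 := hm hpi
      have h2 : M (p - 1) < M i := by
        by_contra hc
        have := hp2 (p - 1) (by omega)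
        omega
      have : q p = p - 1 := (hq p).unique ⟨by omega, by omega, fun j _ _ => by omega⟩
      refine ⟨p, hpi, ?_⟩
      simp only [hf, this]
      omega
    · intro j hj
      have := hm hj
      have := (hq j).1
      simp only [hf]
      omega

lemma shift_const {f : ℤ → ℤ} (h : ∀ i, f (i + 1) = f i) (i : ℤ) : f i = f 0 := by
  induction i using Int.induction_on with
  | zero => rfl
  | succ n ih => rw [h, ih]
  | pred n ih => rw [← ih, ← h (-(n : ℤ) - 1)]; congr 1; ring

lemma window {d : ℕ} {g : ℤ → ℤ} (h : ∀ i, g (i + d) = g i) (i : ℤ) :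
    ∑ t ∈ Finset.range d, g (i + t) = ∑ t ∈ Finset.range d, g t := by
  have := shift_const (f := fun i => ∑ t ∈ Finset.range d, g (i + t)) (by
    intro i
    have h1 := Finset.sum_range_succ (fun t : ℕ => g (i + t)) d
    have h2 := Finset.sum_range_succ' (fun t : ℕ => g (i + t)) d
    have h3 : ∀ t : ℕ, g (i + 1 + t) = g (i + (t + 1 : ℕ)) := by
      intro t; congr 1; push_cast; ring
    simp only [h3]
    simp only [h, Nat.cast_zero, add_zero] at h1 h2
    linarith) i
  simpa using this

lemma sumIoc (d : ℕ) (f : ℤ → ℤ) (j : ℤ) :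
    ∑ x ∈ Finset.Ioc j (j + d), f x = ∑ t ∈ Finset.range d, f (j + 1 + t) := by
  refine Finset.sum_nbij' (fun x => (x - j - 1).toNat) (fun t => j + 1 + t) ?_ ?_ ?_ ?_ ?_
  · intro x hx; simp at hx ⊢; omega
  · intro x hx; simp at hx ⊢; omega
  · intro x hx; simp at hx ⊢; omega
  · intro x hx; omega
  · intro x hx; simp at hx ⊢; congr 1; omega

lemma cut_sum {d : ℕ} {π : ℤ ≃ ℤ} (hp : ∀ i, π (i + d) = π i + d)
    {M : ℤ → ℤ} (h : RM π M) {j : ℤ} (hj : IsCutPointZ π j) :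
    ∑ i ∈ Finset.range d, (π i - i) = d * (M j - j) := by
  rw [← window (g := fun i => π i - i) (fun i => by simp only [hp]; ring) (j + 1)]
  rw [Finset.sum_sub_distrib, ← sumIoc d (fun x => π x) j]
  have hsub : (Finset.Ioc j (j + d)).map π.toEmbedding ⊆ Finset.Ioc (M j) (M j + d) := by
    intro w
    simp only [Finset.mem_map_equiv, Finset.mem_Ioc]
    rintro ⟨h1, h2⟩
    have hw : π (π.symm w) = w := by simp
    constructor
    · obtain ⟨⟨m, hm, e⟩, -⟩ := h j
      have := hj m _ hm h1
      omega
    · have := (h (j + d)).2 _ h2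
      rw [RM.per hp h] at this
      omega
  have heq := Finset.eq_of_subset_of_card_le hsub (by simp)
  have h1 : ∑ x ∈ Finset.Ioc j (j + d), π x = ∑ x ∈ Finset.Ioc (M j) (M j + d), x := by
    rw [← heq, Finset.sum_map]; rfl
  rw [h1, sumIoc d (fun x => x), ← Finset.sum_sub_distrib]
  rw [Finset.sum_congr rfl (fun (t : ℕ) _ => show (M j + 1 + (t : ℤ)) - (j + 1 + (t : ℤ)) = M j - j by ring)]
  simp
  ring

lemma cut_iff {d : ℕ} (hd : 1 ≤ d) {π : ℤ ≃ ℤ} (hp : ∀ i, π (i + d) = π i + d)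
    (ha : Avoids312Z π) {M : ℤ → ℤ} (h : RM π M) (j : ℤ) :
    IsCutPointZ π j ↔ ∀ i, M j - j ≤ M i - i := by
  have hM := RM.per hp h
  have hm := h.mono
  choose q hq hf using formula hd hp ha h
  have hst : ∀ i i', i < i' → (i ≤ q i' → π i < π i') ∧ (q i' < i → π i' < π i) := by
    intro i i' hi
    rw [hf i, hf i']
    exact step hm hq hi
  constructor
  · intro hj
    have hgt : ∀ i, j < i → M j - j ≤ M i - i := by
      intro i hi
      by_contra hc
      obtain ⟨s, ⟨hs1, hs2⟩, hs3⟩ := Int.exists_least_of_bdd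
        (P := fun s => j < s ∧ M s - s < M j - j) ⟨j, fun z hz => hz.1.le⟩ ⟨i, hi, by omega⟩
      have h1 := hj j s le_rfl hs1
      have h2 : j ≤ q s := by
        by_contra hc
        have := (hst j s hs1).2 (by omega)
        omega
      have h3 := (hq s).2.1
      have h4 := (hq s).1
      have h5 : j ≠ q s := by intro e; rw [← e] at h3; omega
      have := hs3 (q s) ⟨by omega, by omega⟩
      omega
    intro i
    have hper : Function.Periodic (fun i => M i - i) (d : ℤ) := fun i => by simp only [hM]; ring
    have h1 := hper.int_mul ((j - i).toNat + 1) i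
    rw [Int.cast_id] at h1
    rw [← h1]
    apply hgt
    have : (1 : ℤ) ≤ d := by exact_mod_cast hd
    nlinarith [Int.self_le_toNat (j - i), Int.natCast_nonneg (j - i).toNat]
  · intro hmin i k hi hk
    have : j ≤ q k := by
      by_contra hc
      have := (hq k).2.2 j (by omega) hk
      have := hmin k
      omega
    exact (hst i k (by omega)).1 (by omega)

open Classical in
lemma ncard_eq (d : ℕ) (P : ℤ → Prop) :
    (({j : ℤ | 0 ≤ j ∧ j < d ∧ P j}.ncard : ℕ) : ℤ) =
      ∑ t ∈ Finset.range d, if P t then 1 else 0 := by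
  have : {j : ℤ | 0 ≤ j ∧ j < d ∧ P j} =
      ↑(((Finset.range d).filter (fun t : ℕ => P t)).map (Nat.castEmbedding (R := ℤ))) := by
    ext j
    simp only [Set.mem_ofPred_eq, Finset.coe_map, Set.mem_image, Finset.mem_coe, Finset.mem_filter,
      Finset.mem_range, Nat.castEmbedding_apply]
    constructor
    · rintro ⟨h1, h2, h3⟩
      have : ((j.toNat : ℕ) : ℤ) = j := by omega
      exact ⟨j.toNat, ⟨by omega, by rwa [this]⟩, this⟩
    · rintro ⟨t, ⟨h1, h2⟩, rfl⟩
      exact ⟨by omega, by omega, h2⟩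
  rw [this, Set.ncard_coe_finset, Finset.card_map, Finset.card_filter]
  push_cast
  rfl

/-- indicator of fixed points of `M` -/
def Z (M : ℤ → ℤ) (i : ℤ) : ℤ := if M i = i then 1 else 0

def IsX (d k : ℕ) (π : ℤ ≃ ℤ) : Prop := IsAffinePerm d π ∧ Avoids312Z π ∧
        ({j : ℤ | 0 ≤ j ∧ j < d ∧ IsCutPointZ π j}.ncard = k)

def IsY (d k : ℕ) (M : ℤ → ℤ) : Prop := Monotone M ∧ (∀ i, M (i + d) = M i + d) ∧
  (∀ i, i ≤ M i) ∧ ∑ t ∈ Finset.range d, Z M t = k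

lemma X_to_Y {d k : ℕ} (hk : 1 ≤ k) (hd : 1 ≤ d) {π : ℤ ≃ ℤ} (hX : IsX d k π) :
    ∃ M, IsY d k M ∧ RM π M := by
  obtain ⟨⟨hp, hs⟩, ha, hc⟩ := hX
  obtain ⟨M, h⟩ := exists_RM hd π hp
  have hci := cut_iff hd hp ha h
  have hz : ∀ j, IsCutPointZ π j → M j = j := by
    intro j hj
    have := cut_sum hp h hj
    rw [hs] at this
    have h2 : (d : ℤ) ≠ 0 := by omega
    have := (mul_eq_zero.mp this.symm).resolve_left h2
    omega
  obtain ⟨j0, -, -, hj0⟩ : {j : ℤ | 0 ≤ j ∧ j < d ∧ IsCutPointZ π j}.Nonempty := by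
    apply Set.nonempty_of_ncard_ne_zero
    omega
  have hge : ∀ i, i ≤ M i := by
    intro i
    have := (hci j0).1 hj0 i
    have := hz j0 hj0
    omega
  have hiff : ∀ j, IsCutPointZ π j ↔ M j = j := by
    intro j
    refine ⟨hz j, fun e => (hci j).2 fun i => ?_⟩
    have := hge i
    omega
  refine ⟨M, ⟨h.mono, RM.per hp h, hge, ?_⟩, h⟩
  rw [← hc, ncard_eq]
  simp only [hiff, Z]

lemma Y_to_X {d k : ℕ} (hk : 1 ≤ k) (hd : 1 ≤ d) {M : ℤ → ℤ} (hY : IsY d k M) :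
    ∃ π, IsX d k π ∧ RM π M := by
  obtain ⟨hm, hM, hge, hs⟩ := hY
  obtain ⟨π, hp, ha, h⟩ := exists_perm hd hm hM
  have hci := cut_iff hd hp ha h
  obtain ⟨t, -, ht⟩ : ∃ t ∈ Finset.range d, Z M t ≠ 0 := by
    apply Finset.exists_ne_zero_of_sum_ne_zero
    omega
  have ht : M t = t := by
    by_contra hc
    simp [Z, hc] at ht
  have hiff : ∀ j, IsCutPointZ π j ↔ M j = j := by
    intro j
    rw [hci]
    constructor
    · intro h1
      have := h1 t
      have := hge j
      omega
    · intro e i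
      have := hge i
      omega
  refine ⟨π, ⟨⟨hp, ?_⟩, ha, ?_⟩, h⟩
  · rw [cut_sum hp h ((hiff t).2 ht), ht]; simp
  · zify
    rw [ncard_eq, ← hs]
    simp only [hiff, Z]

lemma card_X_Y {d k : ℕ} (hk : 1 ≤ k) (hd : 1 ≤ d) :
    Nat.card {π // IsX d k π} = Nat.card {M // IsY d k M} := by
  choose f hf hf' using fun π : {π // IsX d k π} => X_to_Y hk hd π.2
  refine Nat.card_congr (Equiv.ofBijective (fun π => ⟨f π, hf π⟩) ⟨?_, ?_⟩)
  · intro π π' e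
    have e' : f π = f π' := congrArg Subtype.val e
    exact Subtype.ext (RM.inj hd π.2.1.1 π.2.2.1 π'.2.1.1 π'.2.2.1 (hf' π) (e' ▸ hf' π'))
  · rintro ⟨M, hM⟩
    obtain ⟨π, hπ, h⟩ := Y_to_X hk hd hM
    exact ⟨⟨π, hπ⟩, Subtype.ext ((hf' ⟨π, hπ⟩).unique h)⟩

lemma anti (f : ℤ → ℤ) : ∃ F : ℤ → ℤ, ∀ i, F (i + 1) = F i + f i := by
  refine ⟨fun i => ∑ x ∈ Finset.Ico 0 i, f x - ∑ x ∈ Finset.Ico i 0, f x, fun i => ?_⟩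
  rcases le_or_gt 0 i with h | h
  · have h1 : Finset.Ico 0 (i + 1) = insert i (Finset.Ico 0 i) := by
      ext x; simp only [Finset.mem_insert, Finset.mem_Ico]; omega
    simp only
    rw [h1, Finset.sum_insert (by simp), Finset.Ico_eq_empty (a := i) (by omega),
      Finset.Ico_eq_empty (a := i + 1) (by omega)]
    simp; ring
  · have h1 : Finset.Ico i 0 = insert i (Finset.Ico (i + 1) 0) := by
      ext x; simp only [Finset.mem_insert, Finset.mem_Ico]; omega
    simp only
    rw [h1, Finset.sum_insert (by simp), Finset.Ico_eq_empty (a := 0) (b := i) (by omega),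
      Finset.Ico_eq_empty (a := 0) (b := i + 1) (by omega)]
    simp

lemma anti_per {d : ℕ} {f F : ℤ → ℤ} (h : ∀ i, F (i + 1) = F i + f i)
    (hf : ∀ i, f (i + d) = f i) (i : ℤ) : F (i + d) = F i + ∑ t ∈ Finset.range d, f t := by
  rw [← window hf i]
  have : ∀ n : ℕ, F (i + n) = F i + ∑ t ∈ Finset.range n, f (i + t) := by
    intro n
    induction n with
    | zero => simp
    | succ n ih =>
      rw [Finset.sum_range_succ, ← add_assoc, ← ih, ← h]
      congr 1; push_cast; ring
  exact this d

/-- reduced increments -/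
def beta (M : ℤ → ℤ) (i : ℤ) : ℤ := M (i + 1) - M i - Z M i

lemma Z_per {d : ℕ} {M : ℤ → ℤ} (hM : ∀ i, M (i + d) = M i + d) (i : ℤ) :
    Z M (i + d) = Z M i := by
  simp [Z, hM]

lemma beta_per {d : ℕ} {M : ℤ → ℤ} (hM : ∀ i, M (i + d) = M i + d) (i : ℤ) :
    beta M (i + d) = beta M i := by
  have h1 : i + d + 1 = i + 1 + d := by ring
  simp only [beta, Z_per hM, h1, hM]
  ring

lemma beta_nonneg {d k : ℕ} {M : ℤ → ℤ} (hY : IsY d k M) (i : ℤ) : 0 ≤ beta M i := by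
  obtain ⟨hm, hM, hge, hs⟩ := hY
  have h1 := hm (show i ≤ i + 1 by omega)
  have h2 := hge (i + 1)
  simp only [beta, Z]
  split_ifs <;> omega

lemma beta_sum {d k : ℕ} {M : ℤ → ℤ} (hY : IsY d k M) :
    ∑ t ∈ Finset.range d, beta M t = d - k := by
  obtain ⟨hm, hM, hge, hs⟩ := hY
  simp only [beta]
  rw [Finset.sum_sub_distrib, hs]
  have := Finset.sum_range_sub (fun t : ℕ => M t) d
  push_cast at this
  rw [this]
  have := hM 0
  simp at this ⊢
  omega

lemma beta_inj_aux {d k : ℕ} (hk : 1 ≤ k) (hd : 1 ≤ d) {M M' c c' : ℤ → ℤ}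
    (hY : IsY d k M) (hY' : IsY d k M')
    (hc : ∀ i, c (i + 1) = c i + Z M i) (hc' : ∀ i, c' (i + 1) = c' i + Z M' i)
    {e : ℤ} (he : ∀ i, M i - c i - (M' i - c' i) = e) (i : ℤ) : c i + e ≤ c' i := by
  have hmono : ∀ {M c : ℤ → ℤ}, (∀ i, c (i + 1) = c i + Z M i) → Monotone c := by
    intro M c hc
    apply monotone_int_of_le_succ
    intro i
    rw [hc]
    simp only [Z]
    split_ifs <;> omega
  have m := hmono hc
  have m' := hmono hc'
  have hcd := anti_per hc (Z_per hY.2.1) (i - d)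
  rw [hY.2.2.2] at hcd
  simp at hcd
  obtain ⟨j, hj, hj2⟩ := Int.exists_greatest_of_bdd (P := fun j => c j < c i)
    ⟨i, fun z hz => by
      by_contra hcc
      have := m (show i ≤ z by omega)
      omega⟩ ⟨i - d, by omega⟩
  have h1 : c i ≤ c (j + 1) := by
    by_contra hcc
    have := hj2 (j + 1) (by omega)
    omega
  have h2 := hc j
  have h3 : M j = j := by
    by_contra hcc
    simp [Z, hcc] at h2
    omega
  simp [Z, h3] at h2
  have hji : j < i := by
    by_contra hcc
    have := m (show i ≤ j by omega)
    omega
  have h4 := m' (show j + 1 ≤ i by omega)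
  have h5 := hc' j
  have h6 := he j
  have h7 := hY'.2.2.1 j
  simp only [Z] at h5
  split_ifs at h5 <;> omega

lemma beta_inj {d k : ℕ} (hk : 1 ≤ k) (hd : 1 ≤ d) {M M' : ℤ → ℤ}
    (hY : IsY d k M) (hY' : IsY d k M') (h : ∀ i, beta M i = beta M' i) : M = M' := by
  obtain ⟨c, hc⟩ := anti (Z M)
  obtain ⟨c', hc'⟩ := anti (Z M')
  obtain ⟨e, he⟩ : ∃ e, ∀ i, M i - c i - (M' i - c' i) = e := ⟨_, shift_const (f := fun i => M i - c i - (M' i - c' i)) (by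
    intro i
    have := h i
    simp only [beta] at this
    simp only [hc, hc']
    omega)⟩
  funext i
  have h1 := beta_inj_aux hk hd hY hY' hc hc' he i
  have h2 := beta_inj_aux hk hd hY' hY hc' hc (e := -e) (fun i => by
    have := he i; omega) i
  have := he i
  omega

lemma beta_surj {d k : ℕ} (hk : 1 ≤ k) (hd : 1 ≤ d) {b : ℤ → ℤ} (hb : ∀ i, 0 ≤ b i)
    (hp : ∀ i, b (i + d) = b i) (hs : ∑ t ∈ Finset.range d, b t = d - k) :
    ∃ M, IsY d k M ∧ ∀ i, beta M i = b i := by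
  obtain ⟨N, hN⟩ := anti b
  have hNd := anti_per hN hp
  rw [hs] at hNd
  have : ∀ i, ∃ m, (∃ j, j < i ∧ N j - j = m) ∧ ∀ j, j < i → m ≤ N j - j := by
    intro i
    obtain ⟨C, hC⟩ := bddL hd (fun j => N j - j) (fun j => by simp only [hNd]; omega) i
    obtain ⟨m, h1, h2⟩ := Int.exists_least_of_bdd
      (P := fun m => ∃ j, j < i ∧ N j - j = m)
      ⟨C, by rintro z ⟨j, hj, rfl⟩; exact hC j hj⟩
      ⟨_, i - 1, by omega, rfl⟩
    exact ⟨m, h1, fun j hj => h2 _ ⟨j, hj, rfl⟩⟩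
  choose m hm1 hm2 using this
  have hmd : ∀ i, m (i + d) = m i - k := by
    intro i
    obtain ⟨j, hj, e⟩ := hm1 i
    obtain ⟨j', hj', e'⟩ := hm1 (i + d)
    have h1 := hm2 (i + d) (j + d) (by omega)
    have h2 := hm2 i (j' - d) (by omega)
    have h3 := hNd (j' - d)
    rw [hNd] at h1
    simp at h3
    omega
  have hlow : ∀ i, m i - 1 ≤ N i - i := by
    intro i
    have h1 := hm2 i (i - 1) (by omega)
    have h2 := hN (i - 1)
    have h3 := hb (i - 1)
    simp at h2
    omega
  have hstep : ∀ i, m (i + 1) = m i - Z (fun i => N i - m i + 1) i := by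
    intro i
    obtain ⟨j, hj, e⟩ := hm1 i
    obtain ⟨j', hj', e'⟩ := hm1 (i + 1)
    have h1 := hm2 (i + 1) j (by omega)
    have h2 := hm2 (i + 1) i (by omega)
    have h3 := hlow i
    have h4 : j' = i ∨ m i ≤ N j' - j' := by
      by_cases h : j' = i
      · exact Or.inl h
      · exact Or.inr (hm2 i j' (by omega))
    simp only [Z]
    rcases h4 with rfl | h4 <;> split_ifs <;> omega
  refine ⟨fun i => N i - m i + 1, ⟨?_, ?_, ?_, ?_⟩, ?_⟩
  · apply monotone_int_of_le_succ
    intro i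
    have h1 := hstep i
    have h2 := hN i
    have h3 := hb i
    have h4 : 0 ≤ Z (fun i => N i - m i + 1) i := by simp only [Z]; split_ifs <;> omega
    omega
  · intro i
    simp only [hNd, hmd]
    ring
  · intro i
    have := hlow i
    simp only
    omega
  · have h1 : ∀ t : ℕ, Z (fun i => N i - m i + 1) t = (fun t : ℕ => m t) t - (fun t : ℕ => m t) (t + 1) := by
      intro t
      have := hstep t
      push_cast
      omega
    rw [Finset.sum_congr rfl (fun t _ => h1 t), Finset.sum_range_sub']
    have := hmd 0
    simp at this ⊢
    omega
  · intro i
    have h1 := hstep i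
    have h2 := hN i
    simp only [beta]
    omega

lemma card_Y_B {d k : ℕ} (hk : 1 ≤ k) (hkd : k ≤ d) :
    Nat.card {M // IsY d k M} = Nat.card {b : Fin d → ℕ // ∑ i, b i = d - k} := by
  have hd : 1 ≤ d := by omega
  refine Nat.card_congr (Equiv.ofBijective
    (fun M => ⟨fun t => (beta M.1 (t : ℕ)).toNat, ?_⟩) ⟨?_, ?_⟩)
  · have h1 := beta_sum M.2
    rw [← Fin.sum_univ_eq_sum_range (fun t : ℕ => beta M.1 t) d] at h1
    zify [hkd]
    rw [← h1]
    refine Finset.sum_congr rfl fun t _ => Int.toNat_of_nonneg (beta_nonneg M.2 _)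
  · intro M M' e
    have e' := congrArg Subtype.val e
    refine Subtype.ext (beta_inj hk hd M.2 M'.2 fun i => ?_)
    have hmod : ∀ {M : ℤ → ℤ}, IsY d k M → beta M i = beta M (i % d) := by
      intro M hM
      have hper : Function.Periodic (beta M) (d : ℤ) := fun i => beta_per hM.2.1 i
      have h1 := hper.int_mul (i / d) (i % d)
      rw [Int.cast_id] at h1
      rw [← h1, mul_comm, Int.emod_add_mul_ediv]
    rw [hmod M.2, hmod M'.2]
    have hn := Int.emod_nonneg i (show (d : ℤ) ≠ 0 by omega)
    have hl := Int.emod_lt_of_pos i (show (0 : ℤ) < d by omega)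
    have h2 := congrFun e' ⟨(i % d).toNat, by omega⟩
    simp only [Int.toNat_of_nonneg hn] at h2
    have := beta_nonneg M.2 (i % d)
    have := beta_nonneg M'.2 (i % d)
    omega
  · rintro ⟨b, hb⟩
    have hl : ∀ i : ℤ, (i % d).toNat < d := fun i => by
      have hn := Int.emod_nonneg i (show (d : ℤ) ≠ 0 by omega)
      have hl := Int.emod_lt_of_pos i (show (0 : ℤ) < d by omega)
      omega
    have hv : ∀ t : Fin d, (⟨(((t : ℕ) : ℤ) % d).toNat, hl _⟩ : Fin d) = t := by
      intro t
      apply Fin.ext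
      simp only
      rw [Int.emod_eq_of_lt (by omega) (by have := t.2; omega)]
      simp
    obtain ⟨M, hM, h⟩ := beta_surj hk hd (b := fun i => (b ⟨(i % d).toNat, hl i⟩ : ℤ))
      (fun i => by positivity) (fun i => by simp) (by
        rw [← Fin.sum_univ_eq_sum_range
          (fun t : ℕ => (b ⟨((t : ℤ) % d).toNat, hl t⟩ : ℤ)) d]
        simp only [hv]
        zify [hkd] at hb
        exact hb)
    refine ⟨⟨M, hM⟩, Subtype.ext (funext fun t => ?_)⟩
    simp only [h, hv]
    simp

lemma card_B (d n : ℕ) :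
    Nat.card {b : Fin d → ℕ // ∑ i, b i = n} = (d + n - 1).choose n := by
  rw [← Nat.card_congr (Sym.equivNatSumOfFintype (Fin d) n), Nat.card_eq_fintype_card,
    Sym.card_sym_eq_choose, Fintype.card_fin]

end Aff

/-- For `1 ≤ k ≤ d`, the number of 312-avoiding affine permutations in `S̃_d` with
exactly `k` cut points modulo `d` (i.e. with exactly `k` cut points in the window
`0 ≤ j < d` of `d` consecutive integers) is `binomial (2d-k-1) (d-1)`. -/
theorem card_312_avoiding_affine_with_k_cut_points (d k : ℕ) (hk : 1 ≤ k) (hkd : k ≤ d) :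
    Nat.card {π : ℤ ≃ ℤ // IsAffinePerm d π ∧ Avoids312Z π ∧
        ({j : ℤ | 0 ≤ j ∧ j < d ∧ IsCutPointZ π j}.ncard = k)}
      = (2 * d - k - 1).choose (d - 1) := by
  have h1 := Aff.card_X_Y hk (hk.trans hkd)
  rw [Aff.card_Y_B hk hkd, Aff.card_B] at h1
  refine h1.trans ?_
  have h2 : d + (d - k) - 1 = 2 * d - k - 1 := by omega
  rw [h2, ← Nat.choose_symm (by omega)]
  congr 1
  omega
end
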